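/- Let X be a Banach space, Ω₁,…,Ωₙ closed subsets of X, x̄ ∈ ⋂ᵢ₌₁ⁿ Ωᵢ, let φ : [0,∞) → [0,∞) be continuous, strictly increasing, with φ(0) = 0 and φ(t) → ∞ as t → ∞, and let δ₁ > 0, δ₂ > 0. Suppose there exists γ > 0 such that for any x' ∈ X satisfying ‖x' − x̄‖ < δ₂ and 0 < max₁≤i≤n d(x',Ωᵢ) < φ⁻¹(δ₁), there exists λ ∈ (φ(max₁≤i≤n d(x',Ωᵢ)), δ₁) such that sup over u₁ ∈ Ω₁,…,uₙ ∈ Ωₙ, u ∈ X with (u₁,…,uₙ,u) ≠ (ω₁,…,ωₙ,x) of the quotient [φ(max₁≤i≤n ‖ωᵢ − x‖) − φ(max₁≤i≤n ‖uᵢ − u‖)] / ‖(u₁−ω₁,…,uₙ−ωₙ,u−x)‖_γ is ≥ 1, for all x ∈ X and ωᵢ, ω'ᵢ ∈ Ωᵢ (i = 1,…,n) satisfying ‖x − x'‖ < λ, max₁≤i≤n ‖ωᵢ − ω'ᵢ‖ < λ/γ, and 0 < max₁≤i≤n ‖ωᵢ − x‖ ≤ max₁≤i≤n ‖ω'ᵢ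 − x'‖ < φ⁻¹(λ). Then {Ω₁,…,Ωₙ} is φ-subtransversal at x̄ with δ₁ and δ₂. -/

import Mathlib

open Set Filter
open scoped ENNReal

variable {X : Type*} [NormedAddCommGroup X] [NormedSpace ℝ X]

/-- The collection `{Ω i}` is `φ`-semitransversal at `x₀` with `δ > 0`:
`⋂ᵢ (Ωᵢ − xᵢ) ∩ B_ρ(x₀) ≠ ∅` for all `ρ ∈ (0,δ)` and all `xᵢ` with `φ(maxᵢ ‖xᵢ‖) < ρ`. -/
def SemitransversalWith {n : ℕ} (Ω : Fin n → Set X) (x₀ : X) (φ : ℝ → ℝ) (δ : ℝ) : Prop :=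
  ∀ ρ : ℝ, 0 < ρ → ρ < δ → ∀ x : Fin n → X, φ (⨆ i, ‖x i‖) < ρ →
    ((⋂ i, (fun u => u - x i) '' Ω i) ∩ Metric.ball x₀ ρ).Nonempty

/-- The collection `{Ω i}` is `φ`-subtransversal at `x₀` with `δ₁, δ₂ > 0`:
`⋂ᵢ Ωᵢ ∩ B_ρ(x) ≠ ∅` for all `ρ ∈ (0,δ₁)` and all `x ∈ B_{δ₂}(x₀)` with
`φ(maxᵢ d(x,Ωᵢ)) < ρ`. -/
def SubtransversalWith {n : ℕ} (Ω : Fin n → Set X) (x₀ : X) (φ : ℝ → ℝ) (δ₁ δ₂ : ℝ) : Prop :=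
  ∀ ρ : ℝ, 0 < ρ → ρ < δ₁ → ∀ x : X, x ∈ Metric.ball x₀ δ₂ →
    φ (⨆ i, Metric.infDist x (Ω i)) < ρ → ((⋂ i, Ω i) ∩ Metric.ball x ρ).Nonempty

/-- The collection `{Ω i}` is `φ`-transversal at `x₀` with `δ₁, δ₂ > 0`:
`⋂ᵢ (Ωᵢ − ωᵢ − xᵢ) ∩ ρ𝔹 ≠ ∅` for all `ρ ∈ (0,δ₁)`, `ωᵢ ∈ Ωᵢ ∩ B_{δ₂}(x₀)` and `xᵢ`
with `φ(maxᵢ ‖xᵢ‖) < ρ`. -/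
def TransversalWith {n : ℕ} (Ω : Fin n → Set X) (x₀ : X) (φ : ℝ → ℝ) (δ₁ δ₂ : ℝ) : Prop :=
  ∀ ρ : ℝ, 0 < ρ → ρ < δ₁ → ∀ ω x : Fin n → X,
    (∀ i, ω i ∈ Ω i ∩ Metric.ball x₀ δ₂) → φ (⨆ i, ‖x i‖) < ρ →
    ((⋂ i, (fun u => u - ω i - x i) '' Ω i) ∩ Metric.ball (0 : X) ρ).Nonempty

theorem Real.iSup_norm_eq_pi_norm {ι E : Type*} [Fintype ι] [SeminormedAddCommGroup E]
    (v : ι → E) : ⨆ i, ‖v i‖ = ‖v‖ := by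
  refine le_antisymm (Real.iSup_le (norm_le_pi_norm v) (norm_nonneg v)) ?_
  rw [pi_norm_le_iff_of_nonneg (Real.iSup_nonneg fun i => norm_nonneg (v i))]
  exact fun i => le_ciSup (f := fun i => ‖v i‖) (Set.finite_range _).bddAbove i

/-- The **Ekeland variational principle** for a nonnegative lower semicontinuous function on a
complete metric space. -/
theorem LowerSemicontinuous.exists_ekeland {E : Type*} [MetricSpace E] [CompleteSpace E]
    {f : E → ℝ} (hf : LowerSemicontinuous f) (hf₀ : ∀ x, 0 ≤ f x) {c : ℝ} (hc : 0 < c) (x₀ : E) :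
    ∃ x, f x + c * dist x x₀ ≤ f x₀ ∧ ∀ y, y ≠ x → f x < f y + c * dist y x := by
  have step (ε : ℝ) (hε : 0 < ε) (x : E) : ∃ y, f y + c * dist y x ≤ f x ∧
      ∀ z, f z + c * dist z x ≤ f x → f y ≤ f z + ε := by
    have hne : (f '' {y | f y + c * dist y x ≤ f x}).Nonempty := ⟨f x, x, by simp, rfl⟩
    have hbdd : BddBelow (f '' {y | f y + c * dist y x ≤ f x}) :=
      ⟨0, by rintro _ ⟨y, -, rfl⟩; exact hf₀ y⟩
    obtain ⟨_, ⟨y, hy, rfl⟩, hlt⟩ := exists_lt_of_csInf_lt hne (lt_add_of_pos_right _ hε)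
    refine ⟨y, hy, fun z hz => hlt.le.trans ?_⟩
    gcongr
    exact csInf_le hbdd ⟨z, hz, rfl⟩
  choose! g hg hmin using step
  let u : ℕ → E := fun k => Nat.rec x₀ (fun k x => g ((1 / 2 : ℝ) ^ k) x) k
  have hpos (k : ℕ) : (0 : ℝ) < (1 / 2) ^ k := by positivity
  have htrans {x y z : E} (hxy : f x + c * dist x y ≤ f y) (hyz : f y + c * dist y z ≤ f z) :
      f x + c * dist x z ≤ f z := by
    have := mul_le_mul_of_nonneg_left (dist_triangle x y z) hc.le
    linarith
  have hle {k m : ℕ} (hkm : k ≤ m) : f (u m) + c * dist (u m) (u k) ≤ f (u k) := by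
    induction m, hkm using Nat.le_induction with
    | base => simp
    | succ m _ ih => exact htrans (hg _ (hpos m) (u m)) ih
  have hanti : Antitone fun k => f (u k) := fun k m hkm => by
    have := mul_nonneg hc.le (dist_nonneg (x := u m) (y := u k))
    linarith [hle hkm]
  have hcauchy : CauchySeq u := by
    have hfc : CauchySeq fun k => f (u k) :=
      (tendsto_atTop_ciInf hanti ⟨0, by rintro _ ⟨k, rfl⟩; exact hf₀ _⟩).cauchySeq
    rw [Metric.cauchySeq_iff'] at hfc ⊢
    intro ε hε
    obtain ⟨N, hN⟩ := hfc (c * ε) (by positivity)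
    refine ⟨N, fun m hm => ?_⟩
    have h₁ := (abs_lt.1 (Real.dist_eq _ _ ▸ hN m hm)).1
    exact lt_of_mul_lt_mul_left (by linarith [hle hm]) hc.le
  obtain ⟨x, hx⟩ := cauchySeq_tendsto_of_complete hcauchy
  have hxu (k : ℕ) : f x + c * dist x (u k) ≤ f (u k) := by
    have hlsc : LowerSemicontinuous fun z => f z + c * dist z (u k) :=
      hf.add (by fun_prop : Continuous fun z => c * dist z (u k)).lowerSemicontinuous
    exact (hlsc.isClosed_preimage (f (u k))).mem_of_tendsto hx
      ((eventually_ge_atTop k).mono fun m hm => hle hm)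
  refine ⟨x, hxu 0, fun y hy => ?_⟩
  by_contra! hyx
  have hfy (k : ℕ) : f x ≤ f y + (1 / 2) ^ k := by
    have h₁ := hmin _ (hpos k) (u k) y (htrans hyx (hxu k))
    have h₂ := mul_nonneg hc.le (dist_nonneg (x := x) (y := u (k + 1)))
    have h₃ := hxu (k + 1)
    have h₄ : f (u (k + 1)) ≤ f y + (1 / 2) ^ k := h₁
    linarith
  have hlim : Tendsto (fun k : ℕ => f y + (1 / 2 : ℝ) ^ k) atTop (nhds (f y + 0)) :=
    (tendsto_pow_atTop_nhds_zero_of_lt_one (by norm_num) (by norm_num)).const_add _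
  have := ge_of_tendsto' hlim hfy
  have := mul_pos hc (dist_pos.2 hy)
  linarith

/-- Theorem 4.2 (nonlocal slope sufficient condition for subtransversality). The
supremum condition "sup ≥ 1" is rendered as: for every `c < 1` there is an admissible
point with quotient `> c`. -/
theorem subtransversal_of_slope_condition {Y : Type*} [NormedAddCommGroup Y]
    [NormedSpace ℝ Y] [CompleteSpace Y] {n : ℕ} (Ω : Fin n → Set Y)
    (hΩ : ∀ i, IsClosed (Ω i)) (x₀ : Y) (hx₀ : x₀ ∈ ⋂ i, Ω i)
    (φ φinv : ℝ → ℝ) (hmono : StrictMonoOn φ (Set.Ici 0)) (hcont : ContinuousOn φ (Set.Ici 0))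
    (hzero : φ 0 = 0) (hlim : Tendsto φ atTop atTop)
    (hinv₁ : ∀ t : ℝ, 0 ≤ t → φinv (φ t) = t) (hinv₂ : ∀ t : ℝ, 0 ≤ t → φ (φinv t) = t)
    (hinvnn : ∀ t : ℝ, 0 ≤ t → 0 ≤ φinv t)
    (δ₁ δ₂ : ℝ) (hδ₁ : 0 < δ₁) (hδ₂ : 0 < δ₂) (γ : ℝ) (hγ : 0 < γ)
    (H : ∀ x' : Y, ‖x' - x₀‖ < δ₂ → 0 < ⨆ i, Metric.infDist x' (Ω i) →
      (⨆ i, Metric.infDist x' (Ω i)) < φinv δ₁ →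
      ∃ lam : ℝ, φ (⨆ i, Metric.infDist x' (Ω i)) < lam ∧ lam < δ₁ ∧
        ∀ (x : Y) (ω ω' : Fin n → Y), (∀ i, ω i ∈ Ω i) → (∀ i, ω' i ∈ Ω i) →
          ‖x - x'‖ < lam → (⨆ i, ‖ω i - ω' i‖) < lam / γ →
          0 < ⨆ i, ‖ω i - x‖ → (⨆ i, ‖ω i - x‖) ≤ ⨆ i, ‖ω' i - x'‖ →
          (⨆ i, ‖ω' i - x'‖) < φinv lam →
          ∀ c : ℝ, c < 1 →
            ∃ (u : Fin n → Y) (u' : Y), (∀ i, u i ∈ Ω i) ∧ (u, u') ≠ (ω, x) ∧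
              c < (φ (⨆ i, ‖ω i - x‖) - φ (⨆ i, ‖u i - u'‖)) /
                    max ‖u' - x‖ (γ * ⨆ i, ‖u i - ω i‖)) :
    SubtransversalWith Ω x₀ φ δ₁ δ₂ := by
  simp only [Real.iSup_norm_eq_pi_norm] at H
  have hxΩ (i : Fin n) : x₀ ∈ Ω i := mem_iInter.1 hx₀ i
  intro ρ hρ hρδ x' hx' hdρ
  rw [mem_ball_iff_norm] at hx'
  set d := ⨆ i, Metric.infDist x' (Ω i) with hd
  have hle_d (i : Fin n) : Metric.infDist x' (Ω i) ≤ d :=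
    le_ciSup (f := fun i => Metric.infDist x' (Ω i)) (Set.finite_range _).bddAbove i
  have hd₀ : 0 ≤ d := Real.iSup_nonneg fun i => Metric.infDist_nonneg
  have lt_inv {s t : ℝ} (hs : 0 ≤ s) (ht : 0 ≤ t) (h : φ s < t) : s < φinv t := by
    rw [← hmono.lt_iff_lt hs (hinvnn t ht), hinv₂ t ht]
    exact h
  obtain hd_zero | hd_pos := hd₀.eq_or_lt
  · refine ⟨x', mem_iInter.2 fun i => ?_, Metric.mem_ball_self hρ⟩
    rw [(hΩ i).mem_iff_infDist_zero ⟨x₀, hxΩ i⟩]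
    exact le_antisymm (hd_zero ▸ hle_d i) Metric.infDist_nonneg
  obtain ⟨lam, hdlam, -, H⟩ := H x' hx' hd_pos (lt_inv hd₀ hδ₁.le (hdρ.trans hρδ))
  set μ := min ρ lam
  have hdμ : φ d < μ := lt_min hdρ hdlam
  have hφd : 0 < φ d := hzero ▸ hmono self_mem_Ici hd₀ hd_pos
  have hμ : 0 < μ := hφd.trans hdμ
  have hlam : 0 < lam := hφd.trans hdlam
  have hdμ' : d < φinv μ := lt_inv hd₀ hμ.le hdμ
  have near (i : Fin n) : ∃ w ∈ Ω i, dist x' w < φinv μ :=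
    (Metric.infDist_lt_iff ⟨x₀, hxΩ i⟩).1 ((hle_d i).trans_lt hdμ')
  choose ω' hω' hω'd using near
  have hω'norm : ‖fun i => ω' i - x'‖ < φinv μ :=
    (pi_norm_lt_iff (hd₀.trans_lt hdμ')).2 fun i => by
      rw [← dist_eq_norm, dist_comm]
      exact hω'd i
  have hφω' : φ ‖fun i => ω' i - x'‖ < μ := by
    rw [← hinv₂ μ hμ.le]
    exact hmono (norm_nonneg _) (hinvnn μ hμ.le) hω'norm
  have hφnn {t : ℝ} (ht : 0 ≤ t) : 0 ≤ φ t := hzero ▸ hmono.monotoneOn self_mem_Ici ht ht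
  -- Rescaling the first factor by `γ` turns the `γ`-norm into the product norm.
  let S : Set ((Fin n → Y) × Y) := {p | ∀ i, γ⁻¹ • p.1 i ∈ Ω i}
  have hS : IsClosed S := by
    simp only [S, ofPred_forall]
    exact isClosed_iInter fun i => (hΩ i).preimage (by fun_prop)
  have : CompleteSpace S := hS.completeSpace_coe
  let f : S → ℝ := fun p => φ ‖fun i => γ⁻¹ • p.1.1 i - p.1.2‖
  have hf : Continuous f := hcont.comp_continuous (by fun_prop) fun p => norm_nonneg _
  let p₀ : S := ⟨(γ • ω', x'), fun i => by simpa [hγ.ne'] using hω' i⟩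
  have hfp₀ : f p₀ < μ := by simpa [f, p₀, hγ.ne'] using hφω'
  obtain ⟨c, hc, hc₁⟩ : ∃ c, f p₀ / μ < c ∧ c < 1 := exists_between ((div_lt_one hμ).2 hfp₀)
  have hc₀ : 0 < c := (div_nonneg (hφnn (norm_nonneg _)) hμ.le).trans_lt hc
  obtain ⟨⟨⟨q, x⟩, hq⟩, hdec, hmin⟩ :=
    hf.lowerSemicontinuous.exists_ekeland (fun p => hφnn (norm_nonneg _)) hc₀ p₀
  obtain ⟨ω, rfl⟩ : ∃ ω, q = γ • ω := ⟨γ⁻¹ • q, by simp [hγ.ne']⟩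
  have hω (i : Fin n) : ω i ∈ Ω i := by simpa [hγ.ne'] using hq i
  have hdist : dist (γ • ω, x) (γ • ω', x') < μ := by
    have h₁ : c * dist (γ • ω, x) (γ • ω', x') ≤ f p₀ :=
      (le_add_of_nonneg_left (hφnn (norm_nonneg _))).trans hdec
    exact lt_of_mul_lt_mul_left (h₁.trans_lt ((div_lt_iff₀ hμ).1 hc)) hc₀.le
  rw [Prod.dist_eq, max_lt_iff, dist_smul₀, dist_eq_norm, dist_eq_norm, Real.norm_of_nonneg hγ.le]
    at hdist
  obtain ⟨hωω', hxx'⟩ := hdist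
  obtain hzero' | hpos := (norm_nonneg fun i => ω i - x).eq_or_lt
  · refine ⟨x, mem_iInter.2 fun i => ?_, mem_ball_iff_norm.2 (hxx'.trans_le (min_le_left _ _))⟩
    have h₁ := congrFun (norm_eq_zero.1 hzero'.symm) i
    exact sub_eq_zero.1 h₁ ▸ hω i
  have hnorm_le : ‖fun i => ω i - x‖ ≤ ‖fun i => ω' i - x'‖ := by
    rw [← hmono.le_iff_le (norm_nonneg _) (norm_nonneg _)]
    have h₁ := (le_add_of_nonneg_right (mul_nonneg hc₀.le dist_nonneg)).trans hdec
    simpa [f, p₀, hγ.ne'] using h₁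
  obtain ⟨u, u', hu, hne, hlt⟩ := H x ω ω' hω hω' (hxx'.trans_le (min_le_right _ _))
    ((lt_div_iff₀' hγ).2 (hωω'.trans_le (min_le_right _ _))) hpos hnorm_le
    (lt_inv (norm_nonneg _) hlam.le (hφω'.trans_le (min_le_right _ _))) c hc₁
  have hne' : (⟨(γ • u, u'), fun i => by simpa [hγ.ne'] using hu i⟩ : S) ≠ ⟨(γ • ω, x), hq⟩ := by
    simpa [hγ.ne'] using hne
  have hslope := hmin _ hne'
  have hdist_pos := dist_pos.2 hne'
  rw [Subtype.dist_eq, Prod.dist_eq, dist_smul₀, dist_eq_norm, dist_eq_norm,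
    Real.norm_of_nonneg hγ.le, max_comm] at hslope hdist_pos
  have hlt' := (lt_div_iff₀ hdist_pos).1 hlt
  simp only [f, Pi.smul_apply, inv_smul_smul₀ hγ.ne'] at hslope
  linarith
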